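/- There exists a triple (α,β,γ) ∈ ℂ³ minimizing Φ over ℂ³ (i.e., Φ(α,β,γ) ≤ Φ(α',β',γ') for all (α',β',γ') ∈ ℂ³), and every such minimizer satisfies: there exist complex numbers z₁, z₂ with |z₁| < 1 and |z₂| < 1 such that α + β·z₁ + γ·z₂ = 0. (This is the counterexample to the Weak Shanks Conjecture: the degree-one optimal polynomial approximant to 1/f in the Hardy space of the bidisk vanishes inside the open bidisk, even though f is zero-free on the closed bidisk.) -/

import Mathlib

open Finset

/-- Maclaurin coefficients of `F(z) = (1 - √(2/3) z)^(-5/2)`. -/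
noncomputable def a : ℕ → ℝ :=
  fun j => ∏ t ∈ Finset.Icc 1 j, (Real.sqrt (2 / 3) * (1 + 3 / (2 * (t : ℝ))))

/-- Taylor coefficients of `f(z₁,z₂) = (1 - (z₁+z₂)/√6)^(-5/2)` at `z₁^k z₂^l`. -/
noncomputable def c : ℕ → ℕ → ℝ :=
  fun k l => a (k + l) * (Nat.choose (k + l) k : ℝ) / 2 ^ (k + l)

/-- Squared `H²(𝔻²)`-norm of `1 - (α + β z₁ + γ z₂) f`. -/
noncomputable def Φ : ℂ → ℂ → ℂ → ℝ :=
  fun α β γ =>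
    ∑' p : ℕ × ℕ,
      ‖(if p = (0, 0) then (1 : ℂ) else 0)
        - α * (c p.1 p.2 : ℂ)
        - β * (if p.1 = 0 then (0 : ℂ) else (c (p.1 - 1) p.2 : ℂ))
        - γ * (if p.2 = 0 then (0 : ℂ) else (c p.1 (p.2 - 1) : ℂ))‖ ^ 2

/-- The radius parameter `√(2/3)`. -/
noncomputable def rr : ℝ := Real.sqrt (2 / 3)

lemma rr_sq : rr ^ 2 = 2 / 3 := Real.sq_sqrt (by norm_num)
lemma rr_nonneg : 0 ≤ rr := Real.sqrt_nonneg _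
lemma rr_lower : 0.816 ≤ rr := Real.le_sqrt_of_sq_le (by norm_num)

lemma a_zero : a 0 = 1 := by simp [a]

lemma a_succ (n : ℕ) : a (n + 1) = a n * (rr * (1 + 3 / (2 * ((n : ℝ) + 1)))) := by
  unfold a rr
  rw [Finset.prod_Icc_succ_top (by omega)]
  push_cast
  rfl

lemma a_pos (n : ℕ) : 0 < a n := by
  induction n with
  | zero => simp [a_zero]
  | succ n ih =>
    rw [a_succ]
    have := rr_lower
    have : 0 < rr := by linarith
    positivity

lemma a_le (n : ℕ) : a n ≤ rr ^ n * (((n : ℝ) + 1) * (n + 2) / 2) := by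
  induction n with
  | zero => simp [a_zero]
  | succ n ih =>
    rw [a_succ]
    have h0 := rr_nonneg
    have h1 : (0 : ℝ) < (n : ℝ) + 1 := by positivity
    have h2 : 1 + 3 / (2 * ((n : ℝ) + 1)) ≤ ((n : ℝ) + 3) / (n + 1) := by
      have : ((n : ℝ) + 3) / (n + 1) - (1 + 3 / (2 * ((n : ℝ) + 1))) = 1 / (2 * ((n : ℝ) + 1)) := by
        field_simp
        ring
      have h3 : 0 ≤ 1 / (2 * ((n : ℝ) + 1)) := by positivity
      linarith
    calc a n * (rr * (1 + 3 / (2 * ((n : ℝ) + 1))))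
        ≤ (rr ^ n * (((n : ℝ) + 1) * (n + 2) / 2)) * (rr * (((n : ℝ) + 3) / (n + 1))) := by
          gcongr
      _ = _ := by
          push_cast
          field_simp
          ring

lemma c_nonneg (k l : ℕ) : 0 ≤ c k l := by
  have := a_pos (k + l)
  unfold c
  positivity

lemma c_symm (k l : ℕ) : c k l = c l k := by
  unfold c
  rw [add_comm k l, Nat.choose_symm_add]

lemma c_le (k l : ℕ) :
    c k l ≤ (rr ^ k * ((k : ℝ) + 1) ^ 2) * (rr ^ l * ((l : ℝ) + 1) ^ 2) := by
  have h0 := rr_nonneg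
  have h1 : c k l ≤ a (k + l) := by
    unfold c
    have : ((k + l).choose k : ℝ) ≤ 2 ^ (k + l) := by
      exact_mod_cast Nat.choose_le_two_pow _ _
    rw [div_le_iff₀ (by positivity)]
    exact mul_le_mul_of_nonneg_left this (a_pos _).le
  refine h1.trans ((a_le _).trans ?_)
  have hk : (0 : ℝ) ≤ k := by positivity
  have hl : (0 : ℝ) ≤ l := by positivity
  have hkl : (0 : ℝ) ≤ k * l := by positivity
  have : (((k + l : ℕ) : ℝ) + 1) * ((k + l : ℕ) + 2) / 2 ≤
      (((k : ℝ) + 1) * (l + 1)) * (((k : ℝ) + 1) * (l + 1)) := by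
    push_cast
    rw [mul_div_assoc]
    apply mul_le_mul <;> first | positivity | nlinarith
  calc rr ^ (k + l) * ((((k + l : ℕ) : ℝ) + 1) * ((k + l : ℕ) + 2) / 2)
      ≤ rr ^ (k + l) * ((((k : ℝ) + 1) * (l + 1)) * (((k : ℝ) + 1) * (l + 1))) := by gcongr
    _ = _ := by ring

lemma summable_g : Summable (fun k : ℕ => (rr ^ k * ((k : ℝ) + 1) ^ 2) ^ 2) := by
  have h := summable_pow_mul_geometric_of_norm_lt_one 4 (r := (2 / 3 : ℝ)) (by norm_num)
  have h' := ((summable_nat_add_iff 1).2 h).mul_left (3 / 2)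
  refine h'.congr fun k => ?_
  have : (rr ^ k) ^ 2 = (2 / 3) ^ k := by rw [← pow_mul, mul_comm, pow_mul, rr_sq]
  rw [mul_pow, this]
  push_cast
  ring

/-- Coefficients of `f`. -/
noncomputable def xx (p : ℕ × ℕ) : ℝ := c p.1 p.2
/-- Coefficients of `z₁ f`. -/
noncomputable def yy (p : ℕ × ℕ) : ℝ := if p.1 = 0 then 0 else c (p.1 - 1) p.2
/-- Coefficients of `z₂ f`. -/
noncomputable def ww (p : ℕ × ℕ) : ℝ := if p.2 = 0 then 0 else c p.1 (p.2 - 1)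

lemma xx_swap (p : ℕ × ℕ) : xx p.swap = xx p := c_symm _ _
lemma yy_swap (p : ℕ × ℕ) : yy p.swap = ww p := by
  simp [yy, ww, c_symm p.1]
lemma ww_swap (p : ℕ × ℕ) : ww p.swap = yy p := by
  rw [← yy_swap, Prod.swap_swap]

lemma summable_xx : Summable (fun p => xx p ^ 2) := by
  have h := summable_g.mul_of_nonneg summable_g (fun _ => sq_nonneg _) (fun _ => sq_nonneg _)
  refine Summable.of_nonneg_of_le (fun _ => sq_nonneg _) (fun p => ?_) h
  rw [← mul_pow]
  exact pow_le_pow_left₀ (c_nonneg _ _) (c_le _ _) 2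

lemma summable_yy : Summable (fun p => yy p ^ 2) := by
  have hi : Function.Injective (fun p : ℕ × ℕ => (p.1 + 1, p.2)) := by
    rintro ⟨a1, b1⟩ ⟨a2, b2⟩ h
    simpa using h
  refine (hi.summable_iff ?_).1 ?_
  · rintro ⟨k, l⟩ hk
    rcases k with _ | k
    · simp [yy]
    · exact absurd ⟨(k, l), rfl⟩ hk
  · refine summable_xx.congr fun p => ?_
    simp [yy, xx]

lemma summable_ww : Summable (fun p => ww p ^ 2) := by
  have := (Equiv.prodComm ℕ ℕ).summable_iff.2 summable_yy
  refine this.congr fun p => ?_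
  simp [yy_swap]

lemma summable_mul_of_sq {u v : ℕ × ℕ → ℝ} (hu : Summable (fun p => u p ^ 2))
    (hv : Summable (fun p => v p ^ 2)) : Summable (fun p => u p * v p) := by
  refine Summable.of_norm_bounded (hu.add hv) fun p => ?_
  rw [Real.norm_eq_abs, abs_le]
  constructor <;> nlinarith [sq_nonneg (u p + v p), sq_nonneg (u p - v p), sq_nonneg (u p),
    sq_nonneg (v p)]

/-- half of the coefficients of `(z₁ + z₂) f`. -/
noncomputable def hh (p : ℕ × ℕ) : ℝ := (yy p + ww p) / 2
/-- half of the coefficients of `(z₁ - z₂) f`. -/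
noncomputable def gg (p : ℕ × ℕ) : ℝ := (yy p - ww p) / 2

lemma summable_hh : Summable (fun p => hh p ^ 2) := by
  refine Summable.of_nonneg_of_le (fun _ => sq_nonneg _) (fun p => ?_) (summable_yy.add summable_ww)
  unfold hh
  nlinarith [sq_nonneg (yy p + ww p), sq_nonneg (yy p - ww p), sq_nonneg (yy p), sq_nonneg (ww p)]

lemma summable_gg : Summable (fun p => gg p ^ 2) := by
  refine Summable.of_nonneg_of_le (fun _ => sq_nonneg _) (fun p => ?_) (summable_yy.add summable_ww)
  unfold gg
  nlinarith [sq_nonneg (yy p + ww p), sq_nonneg (yy p - ww p), sq_nonneg (yy p), sq_nonneg (ww p)]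

lemma hh_swap (p : ℕ × ℕ) : hh p.swap = hh p := by
  unfold hh
  rw [yy_swap, ww_swap, add_comm]
lemma gg_swap (p : ℕ × ℕ) : gg p.swap = - gg p := by
  unfold gg
  rw [yy_swap, ww_swap]
  ring

lemma tsum_anti {u : ℕ × ℕ → ℝ} (hu : ∀ p, u p.swap = - u p) : ∑' p, u p = 0 := by
  have h := (Equiv.prodComm ℕ ℕ).tsum_eq u
  have h2 : ∑' p, u (Equiv.prodComm ℕ ℕ p) = - ∑' p, u p := by
    rw [← tsum_neg]
    exact tsum_congr hu
  linarith

/-- Gram entries. -/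
noncomputable def gA : ℝ := ∑' p, xx p ^ 2
/-- Gram entries. -/
noncomputable def gE : ℝ := ∑' p, hh p ^ 2
/-- Gram entries. -/
noncomputable def gG : ℝ := ∑' p, gg p ^ 2
/-- Gram entries. -/
noncomputable def gB : ℝ := ∑' p, xx p * hh p

lemma hasSum_xg : HasSum (fun p => xx p * gg p) 0 := by
  have h := (summable_mul_of_sq summable_xx summable_gg).hasSum
  rwa [tsum_anti] at h
  intro p
  rw [xx_swap, gg_swap]
  ring

lemma hasSum_hg : HasSum (fun p => hh p * gg p) 0 := by
  have h := (summable_mul_of_sq summable_hh summable_gg).hasSum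
  rwa [tsum_anti] at h
  intro p
  rw [hh_swap, gg_swap]
  ring

lemma Phi_eq (α β γ : ℂ) : Φ α β γ = 1 - 2 * α.re + gA * (α.re ^ 2 + α.im ^ 2)
    + gE * ((β + γ).re ^ 2 + (β + γ).im ^ 2) + gG * ((β - γ).re ^ 2 + (β - γ).im ^ 2)
    + 2 * gB * (α.re * (β + γ).re + α.im * (β + γ).im) := by
  have hδ : HasSum (fun p : ℕ × ℕ => if p = (0, 0) then 1 - 2 * α.re else 0) (1 - 2 * α.re) :=
    hasSum_ite_eq (0, 0) _
  have h := ((((hδ.add (summable_xx.hasSum.mul_right (α.re ^ 2 + α.im ^ 2))).add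
    (summable_hh.hasSum.mul_right ((β + γ).re ^ 2 + (β + γ).im ^ 2))).add
    (summable_gg.hasSum.mul_right ((β - γ).re ^ 2 + (β - γ).im ^ 2))).add
    ((summable_mul_of_sq summable_xx summable_hh).hasSum.mul_right
      (2 * (α.re * (β + γ).re + α.im * (β + γ).im)))).add
    ((hasSum_xg.mul_right (2 * (α.re * (β - γ).re + α.im * (β - γ).im))).add
    (hasSum_hg.mul_right (2 * ((β + γ).re * (β - γ).re + (β + γ).im * (β - γ).im))))
  have h2 := h.tsum_eq
  unfold Φ
  refine Eq.trans ?_ (h2.trans ?_)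
  · refine tsum_congr fun p => ?_
    have e1 : (if p.1 = 0 then (0 : ℂ) else (c (p.1 - 1) p.2 : ℂ)) = ((yy p : ℝ) : ℂ) := by
      unfold yy; split_ifs <;> simp
    have e2 : (if p.2 = 0 then (0 : ℂ) else (c p.1 (p.2 - 1) : ℂ)) = ((ww p : ℝ) : ℂ) := by
      unfold ww; split_ifs <;> simp
    have e3 : (c p.1 p.2 : ℂ) = ((xx p : ℝ) : ℂ) := rfl
    rw [e1, e2, e3, Complex.sq_norm, Complex.normSq_apply]
    by_cases hp : p = (0, 0)
    · have x0 : xx p = 1 := by simp [hp, xx, c, a_zero]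
      have y0 : yy p = 0 := by simp [hp, yy]
      have w0 : ww p = 0 := by simp [hp, ww]
      simp [hp] at x0 y0 w0 ⊢
      simp [x0, y0, w0, hh, gg]
      ring
    · simp [hp, hh, gg]
      ring
  · simp only [gA, gE, gG, gB]
    ring

/-- The quantities `a_m² ω_{m+1}`. -/
noncomputable def vv : ℕ → ℝ
  | 0 => 1 / 2
  | m + 1 => vv m * ((2 / 3) * (1 + 3 / (2 * ((m : ℝ) + 1))) ^ 2 * ((2 * m + 3) / (2 * m + 4)))

lemma vv_pos (m : ℕ) : 0 < vv m := by
  induction m with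
  | zero => norm_num [vv]
  | succ m ih => rw [vv]; positivity

lemma vv_eq (m : ℕ) : vv m = a m ^ 2 * ((Nat.centralBinom (m + 1) : ℝ) / 4 ^ (m + 1)) := by
  induction m with
  | zero => norm_num [vv, a_zero, Nat.centralBinom, Nat.choose]
  | succ m ih =>
    rw [vv, ih, a_succ]
    have h := Nat.succ_mul_centralBinom_succ (m + 1)
    have h' : ((m : ℝ) + 1 + 1) * (Nat.centralBinom (m + 1 + 1) : ℝ)
        = 2 * (2 * ((m : ℝ) + 1) + 1) * (Nat.centralBinom (m + 1) : ℝ) := by exact_mod_cast h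
    have h3 : (Nat.centralBinom (m + 1 + 1) : ℝ)
        = 2 * (2 * ((m : ℝ) + 1) + 1) * (Nat.centralBinom (m + 1) : ℝ) / ((m : ℝ) + 1 + 1) := by
      rw [← h']; field_simp
    rw [h3, mul_pow (a m), mul_pow rr, rr_sq, pow_succ 4 (m + 1)]
    have : (2 * (m : ℝ) + 4) = 2 * ((m : ℝ) + 1 + 1) := by ring
    rw [this]
    field_simp
    ring

/-- Diagonal terms of the key series. -/
noncomputable def tt (m : ℕ) : ℝ := vv m * (rr * (1 + 3 / (2 * ((m : ℝ) + 1))) - 1)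

lemma partial_15 : vv 15 + 0.01 ≤ ∑ m ∈ Finset.range 15, tt m := by
  have h := rr_lower
  norm_num [Finset.sum_range_succ, tt, vv]
  linarith

lemma vv_ratio (m : ℕ) (hm : 15 ≤ m) : vv (m + 1) ≤ 0.8 * vv m := by
  rw [vv, mul_comm 0.8]
  have hm' : (15 : ℝ) ≤ m := by exact_mod_cast hm
  refine mul_le_mul_of_nonneg_left ?_ (vv_pos m).le
  have h1 : 3 / (2 * ((m : ℝ) + 1)) ≤ 3 / 32 := by
    gcongr
    linarith
  have h2 : (2 * (m : ℝ) + 3) / (2 * m + 4) ≤ 1 := by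
    rw [div_le_one (by positivity)]
    linarith
  calc (2 / 3) * (1 + 3 / (2 * ((m : ℝ) + 1))) ^ 2 * ((2 * m + 3) / (2 * m + 4))
      ≤ (2 / 3) * (1 + 3 / 32) ^ 2 * 1 := by gcongr
    _ ≤ 0.8 := by norm_num

lemma partial_ge (m : ℕ) (hm : 15 ≤ m) : vv m + 0.01 ≤ ∑ i ∈ Finset.range m, tt i := by
  induction m, hm using Nat.le_induction with
  | base => exact partial_15
  | succ m hm ih =>
    rw [Finset.sum_range_succ]
    have h1 := vv_ratio m hm
    have h2 := vv_pos m
    have h3 := rr_lower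
    have h4 : -0.2 * vv m ≤ tt m := by
      unfold tt
      have : 0 ≤ 3 / (2 * ((m : ℝ) + 1)) := by positivity
      have : (-0.2 : ℝ) ≤ rr * (1 + 3 / (2 * ((m : ℝ) + 1))) - 1 := by nlinarith
      nlinarith
    linarith

lemma hh_formula (k l m : ℕ) (h : k + l = m + 1) :
    hh (k, l) = a m * ((m + 1).choose k : ℝ) / 2 ^ (m + 1) := by
  unfold hh yy ww c
  rcases k with _ | k
  · obtain rfl : l = m + 1 := by omega
    simp
    ring
  · rcases l with _ | l
    · obtain rfl : k = m := by omega
      simp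
      ring
    · obtain rfl : m = k + l + 1 := by omega
      have e1 : k + (l + 1) = k + l + 1 := by ring
      have e2 : k + 1 + l = k + l + 1 := by ring
      simp only [Nat.add_sub_cancel, e1, e2, Nat.succ_ne_zero, if_false]
      rw [Nat.choose_succ_succ (k + l + 1) k]
      push_cast
      ring

lemma xx_formula (k l n : ℕ) (h : k + l = n) :
    xx (k, l) = a n * (n.choose k : ℝ) / 2 ^ n := by
  subst h
  rfl

lemma choose_sq_sum (n : ℕ) : ∑ p ∈ Finset.HasAntidiagonal.antidiagonal n, ((n.choose p.1 : ℝ)) ^ 2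
    = (Nat.centralBinom n : ℝ) := by
  rw [Finset.Nat.sum_antidiagonal_eq_sum_range_succ_mk, Nat.centralBinom,
    ← Nat.sum_range_choose_sq]
  push_cast
  rfl

lemma diag_sum (m : ℕ) :
    ∑ p ∈ Finset.HasAntidiagonal.antidiagonal (m + 1), (xx p * hh p - hh p ^ 2) = tt m := by
  have : ∀ p ∈ Finset.HasAntidiagonal.antidiagonal (m + 1), xx p * hh p - hh p ^ 2
      = ((m + 1).choose p.1 : ℝ) ^ 2 * ((a (m + 1) * a m - a m ^ 2) / 4 ^ (m + 1)) := by
    rintro ⟨k, l⟩ hp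
    have hp' : k + l = m + 1 := by simpa using hp
    rw [hh_formula k l m hp', xx_formula k l _ hp']
    have : (4 : ℝ) ^ (m + 1) = (2 ^ (m + 1)) ^ 2 := by
      rw [← pow_mul, mul_comm, pow_mul]; norm_num
    rw [this]
    field_simp
  rw [Finset.sum_congr rfl this, ← Finset.sum_mul, choose_sq_sum, tt, vv_eq, a_succ]
  ring

lemma gB_gt : gE < gB := by
  have h := (summable_mul_of_sq summable_xx summable_hh).hasSum.sub summable_hh.hasSum
  have h2 := (Finset.HasAntidiagonal.sigmaAntidiagonalEquivProd (A := ℕ)).hasSum_iff.2 h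
  have h3 := h2.sigma (fun n => Finset.hasSum (Finset.HasAntidiagonal.antidiagonal n)
    (fun p => xx p * hh p - hh p ^ 2))
  have h4 := (hasSum_nat_add_iff' 1).2 h3
  simp only [diag_sum] at h4
  have h5 := h4.tendsto_sum_nat
  have h6 := ge_of_tendsto h5 (Filter.eventually_atTop.2 ⟨15, fun m hm =>
    (show (0.01 : ℝ) ≤ _ from by linarith [partial_ge m hm, vv_pos m])⟩)
  have h00 : hh (0, 0) = 0 := by simp [hh, yy, ww]
  simp [h00] at h6
  unfold gE gB
  norm_num at h6 ⊢
  linarith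

lemma gE_pos : 0 < gE := by
  refine summable_hh.tsum_pos (fun _ => sq_nonneg _) (1, 0) ?_
  rw [hh_formula 1 0 0 rfl, a_zero]
  norm_num

lemma gG_nonneg : 0 ≤ gG := tsum_nonneg fun _ => sq_nonneg _

lemma Phi_nonneg (α β γ : ℂ) : 0 ≤ Φ α β γ := tsum_nonneg fun _ => sq_nonneg _

/-- Schur complement. -/
noncomputable def gK : ℝ := gA - gB ^ 2 / gE

lemma Phi_eq2 (α β γ : ℂ) : Φ α β γ = 1 - 2 * α.re + gK * (α.re ^ 2 + α.im ^ 2)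
    + gE * (((β + γ).re + gB / gE * α.re) ^ 2 + ((β + γ).im + gB / gE * α.im) ^ 2)
    + gG * ((β - γ).re ^ 2 + (β - γ).im ^ 2) := by
  rw [Phi_eq, gK]
  have := gE_pos.ne'
  field_simp
  ring

lemma gK_pos : 0 < gK := by
  have h := Phi_nonneg 1 (((-(gB / gE) / 2 : ℝ)) : ℂ) (((-(gB / gE) / 2 : ℝ)) : ℂ)
  rw [Phi_eq2] at h
  simp only [← Complex.ofReal_add, ← Complex.ofReal_sub, Complex.ofReal_re, Complex.ofReal_im,
    Complex.one_re, Complex.one_im] at h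
  ring_nf at h
  linarith

/-- A minimizer of `Φ` exists, and every minimizer `(α,β,γ)` gives a polynomial
`α + β z₁ + γ z₂` vanishing somewhere in the open bidisk. -/
theorem weak_shanks_counterexample :
    (∃ α β γ : ℂ, ∀ α' β' γ' : ℂ, Φ α β γ ≤ Φ α' β' γ') ∧
    (∀ α β γ : ℂ, (∀ α' β' γ' : ℂ, Φ α β γ ≤ Φ α' β' γ') →
      ∃ z₁ z₂ : ℂ, ‖z₁‖ < 1 ∧ ‖z₂‖ < 1 ∧ α + β * z₁ + γ * z₂ = 0) := by
  have hK := gK_pos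
  have hE := gE_pos
  have hG := gG_nonneg
  have hB := gB_gt
  constructor
  · refine ⟨((1 / gK : ℝ) : ℂ), ((-(gB / gE * (1 / gK)) / 2 : ℝ) : ℂ),
      ((-(gB / gE * (1 / gK)) / 2 : ℝ) : ℂ), fun α' β' γ' => ?_⟩
    rw [Phi_eq2 α', Phi_eq2]
    simp only [← Complex.ofReal_add, ← Complex.ofReal_sub, Complex.ofReal_re, Complex.ofReal_im]
    have h1 : 0 ≤ gE * (((β' + γ').re + gB / gE * α'.re) ^ 2
        + ((β' + γ').im + gB / gE * α'.im) ^ 2) := by positivity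
    have h2 : 0 ≤ gG * ((β' - γ').re ^ 2 + (β' - γ').im ^ 2) := by positivity
    have h3 : 0 ≤ gK * ((α'.re - 1 / gK) ^ 2 + α'.im ^ 2) := by positivity
    have h4 : gK * ((α'.re - 1 / gK) ^ 2 + α'.im ^ 2)
        = gK * (α'.re ^ 2 + α'.im ^ 2) - 2 * α'.re + 1 / gK := by
      field_simp
      ring
    have h5 : gK * ((1 / gK) ^ 2 + 0 ^ 2) = 1 / gK := by field_simp; ring
    rw [h5]
    ring_nf at h1 h2 h3 h4 ⊢
    linarith
  · intro α β γ hmin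
    set s : ℂ := ((-(gB / gE) : ℝ) : ℂ) * α with hs
    have h := hmin α ((s + (β - γ)) / 2) ((s - (β - γ)) / 2)
    rw [Phi_eq2 α β γ, Phi_eq2] at h
    have e1 : (s + (β - γ)) / 2 + (s - (β - γ)) / 2 = s := by ring
    have e2 : (s + (β - γ)) / 2 - (s - (β - γ)) / 2 = β - γ := by ring
    have e3 : s.re = -(gB / gE) * α.re := by rw [hs, Complex.re_ofReal_mul]
    have e4 : s.im = -(gB / gE) * α.im := by rw [hs, Complex.im_ofReal_mul]
    rw [e1, e2, e3, e4] at h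
    have h0 : ((β + γ).re + gB / gE * α.re) ^ 2 + ((β + γ).im + gB / gE * α.im) ^ 2 ≤ 0 := by
      by_contra hc
      push Not at hc
      have := mul_pos hE hc
      ring_nf at h this
      linarith
    have q1 : (β + γ).re + gB / gE * α.re = 0 := by
      nlinarith [sq_nonneg ((β + γ).re + gB / gE * α.re), sq_nonneg ((β + γ).im + gB / gE * α.im)]
    have q2 : (β + γ).im + gB / gE * α.im = 0 := by
      nlinarith [sq_nonneg ((β + γ).re + gB / gE * α.re), sq_nonneg ((β + γ).im + gB / gE * α.im)]
    have hBpos : 0 < gB := hE.trans hB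
    have hz : ‖((gE / gB : ℝ) : ℂ)‖ < 1 := by
      rw [Complex.norm_real, Real.norm_eq_abs, abs_of_pos (by positivity)]
      exact (div_lt_one hBpos).2 hB
    refine ⟨((gE / gB : ℝ) : ℂ), ((gE / gB : ℝ) : ℂ), hz, hz, ?_⟩
    have hsum : β + γ = s := by
      apply Complex.ext
      · rw [e3]; linarith
      · rw [e4]; linarith
    rw [add_assoc, ← add_mul, hsum, hs, mul_right_comm, ← Complex.ofReal_mul]
    have : -(gB / gE) * (gE / gB) = -1 := by field_simp
    rw [this]
    simp
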